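/- Let n ≥ 1, let E = EuclideanSpace ℝ (Fin n), let u : E → ℝ be twice continuously differentiable, let κ ≥ 0, and let β : ℝ → E be differentiable on [t₁, t₂] with β'(t) = ∇u(β(t)) for all t ∈ [t₁, t₂]. If Δ_∞u(β(t)) ≥ −κ/2 for all t ∈ [t₁, t₂], where Δ_∞u(x) := ⟪(fderiv ℝ (∇u) x)(∇u x), ∇u x⟫, then the function t ↦ u(β(t)) + (κ/2) t² is convex on [t₁, t₂]; equivalently, t ↦ ‖∇u(β(t))‖² + κ t is monotone non-decreasing on [t₁, t₂]. In particular, if Δ_∞u ≥ 0 along β then the speed ‖∇u(β(t))‖ is non-decreasing. -/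

import Mathlib

open Set RealInnerProductSpace

section Streamline

variable {F : Type*} [NormedAddCommGroup F] [InnerProductSpace ℝ F] [CompleteSpace F]

theorem ContDiff.differentiable_gradient {u : F → ℝ} (hu : ContDiff ℝ 2 u) :
    Differentiable ℝ (gradient u) := by
  have h : ContDiff ℝ 1 (fderiv ℝ u) := hu.fderiv_right (by norm_num)
  exact (InnerProductSpace.toDual ℝ F).symm.toContinuousLinearEquiv.differentiable.comp
    (h.differentiable one_ne_zero)

theorem hasDerivAt_comp_streamline {u : F → ℝ} {β : ℝ → F} {t : ℝ}
    (hu : DifferentiableAt ℝ u (β t)) (hβ : HasDerivAt β (gradient u (β t)) t) :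
    HasDerivAt (fun s => u (β s)) (‖gradient u (β t)‖ ^ 2) t := by
  have h := hu.hasGradientAt.hasFDerivAt.comp_hasDerivAt t hβ
  rwa [InnerProductSpace.toDual_apply_apply, real_inner_self_eq_norm_sq] at h

theorem hasDerivAt_norm_gradient_sq_streamline {u : F → ℝ} {β : ℝ → F} {t : ℝ}
    (hu : DifferentiableAt ℝ (gradient u) (β t)) (hβ : HasDerivAt β (gradient u (β t)) t) :
    HasDerivAt (fun s => ‖gradient u (β s)‖ ^ 2)
      (2 * ⟪(fderiv ℝ (gradient u) (β t)) (gradient u (β t)), gradient u (β t)⟫) t := by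
  have h := (hu.hasFDerivAt.comp_hasDerivAt t hβ).norm_sq
  rwa [real_inner_comm] at h

theorem monotoneOn_norm_gradient_sq_add_mul {u : F → ℝ} (hu : ContDiff ℝ 2 u) {κ t₁ t₂ : ℝ}
    {β : ℝ → F} (hβ : ∀ t ∈ Icc t₁ t₂, HasDerivAt β (gradient u (β t)) t)
    (hinf : ∀ t ∈ Icc t₁ t₂,
      -(κ / 2) ≤ ⟪(fderiv ℝ (gradient u) (β t)) (gradient u (β t)), gradient u (β t)⟫) :
    MonotoneOn (fun t => ‖gradient u (β t)‖ ^ 2 + κ * t) (Icc t₁ t₂) := by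
  have hd : ∀ t ∈ Icc t₁ t₂, HasDerivAt (fun t => ‖gradient u (β t)‖ ^ 2 + κ * t)
      (2 * ⟪(fderiv ℝ (gradient u) (β t)) (gradient u (β t)), gradient u (β t)⟫ + κ * 1) t :=
    fun t ht => (hasDerivAt_norm_gradient_sq_streamline (hu.differentiable_gradient _)
      (hβ t ht)).add ((hasDerivAt_id t).const_mul κ)
  refine monotoneOn_of_deriv_nonneg (convex_Icc _ _)
    (fun t ht => (hd t ht).continuousAt.continuousWithinAt)
    (fun t ht => (hd t (interior_subset ht)).differentiableAt.differentiableWithinAt)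
    fun t ht => ?_
  rw [(hd t (interior_subset ht)).deriv]
  linarith [hinf t (interior_subset ht)]

end Streamline

/-- If along a streamline of a `C²` function the `∞`-Laplacian is bounded below by
`−κ/2`, then `t ↦ u(β(t)) + (κ/2)t²` is convex, equivalently
`t ↦ ‖∇u(β(t))‖² + κt` is non-decreasing; in particular if `Δ_∞u ≥ 0` along the
streamline then the speed `‖∇u(β(t))‖` is non-decreasing. -/
theorem quantitative_convexity_along_streamline (n : ℕ) (hn : 1 ≤ n)
    (u : EuclideanSpace ℝ (Fin n) → ℝ)
    (hu : ContDiff ℝ 2 u)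
    (κ : ℝ) (hκ : 0 ≤ κ)
    (t₁ t₂ : ℝ)
    (β : ℝ → EuclideanSpace ℝ (Fin n))
    (hβ : ∀ t ∈ Set.Icc t₁ t₂, HasDerivAt β (gradient u (β t)) t)
    (hinf : ∀ t ∈ Set.Icc t₁ t₂,
      -(κ / 2) ≤ ⟪(fderiv ℝ (gradient u) (β t)) (gradient u (β t)), gradient u (β t)⟫) :
    ConvexOn ℝ (Set.Icc t₁ t₂) (fun t => u (β t) + (κ / 2) * t ^ 2) ∧
    MonotoneOn (fun t => ‖gradient u (β t)‖ ^ 2 + κ * t) (Set.Icc t₁ t₂) ∧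
    ((∀ t ∈ Set.Icc t₁ t₂,
        0 ≤ ⟪(fderiv ℝ (gradient u) (β t)) (gradient u (β t)), gradient u (β t)⟫) →
      MonotoneOn (fun t => ‖gradient u (β t)‖) (Set.Icc t₁ t₂)) := by
  have hmono := monotoneOn_norm_gradient_sq_add_mul hu hβ hinf
  refine ⟨?_, hmono, fun h0 s hs t ht hst => ?_⟩
  · have hd : ∀ t ∈ Icc t₁ t₂, HasDerivAt (fun t => u (β t) + (κ / 2) * t ^ 2)
        (‖gradient u (β t)‖ ^ 2 + κ * t) t := fun t ht => by
      refine ((hasDerivAt_comp_streamline (hu.differentiable two_ne_zero _) (hβ t ht)).add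
        ((hasDerivAt_pow 2 t).const_mul (κ / 2))).congr_deriv ?_
      push_cast
      ring
    refine MonotoneOn.convexOn_of_deriv (convex_Icc _ _)
      (fun t ht => (hd t ht).continuousAt.continuousWithinAt)
      (fun t ht => (hd t (interior_subset ht)).differentiableAt.differentiableWithinAt)
      ((hmono.mono interior_subset).congr fun t ht => ?_)
    exact (hd t (interior_subset ht)).deriv.symm
  · have h := monotoneOn_norm_gradient_sq_add_mul (κ := 0) hu hβ
      (fun t ht => by simpa using h0 t ht) hs ht hst
    simp only [zero_mul, add_zero] at h
    exact (sq_le_sq₀ (norm_nonneg _) (norm_nonneg _)).1 h
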